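/- Let n ≥ 2 and let Y be an unbounded closed subset of ℝ^{n+1}. Then 𝔜(Y) = {c·𝟙 + ψ : c ∈ ℝ, ψ ∈ 𝔜₀(Y)} is a closed linear subspace of the Banach space 𝔜′(Y), and the decomposition is unique: 𝟙 ∉ 𝔜₀(Y), so every element of 𝔜(Y) is of the form c·𝟙 + ψ for exactly one pair (c, ψ) ∈ ℝ × 𝔜₀(Y). -/

import Mathlib

/- Function spaces 𝔚, 𝔛, 𝔜′, 𝔜₀, 𝔜 on `Y × 𝕊ⁿ` from Bernstein–Wang,
"A mountain-pass theorem for asymptotically conical self-expanders". -/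

noncomputable section

open Set Metric Real Filter
open scoped RealInnerProductSpace

/-- `ℝ^{n+1}` as a Euclidean space. -/
abbrev Euc (n : ℕ) : Type := EuclideanSpace ℝ (Fin (n + 1))

/-- The unit sphere `𝕊ⁿ ⊆ ℝ^{n+1}`. -/
def Sph (n : ℕ) : Set (Euc n) := Metric.sphere (0 : Euc n) 1

/-- The set `Y × 𝕊ⁿ` inside `ℝ^{n+1} × ℝ^{n+1}`. -/
def pts {n : ℕ} (Y : Set (Euc n)) : Set (Euc n × Euc n) := Y ×ˢ Sph n

/-- The weight `(1+|p|)^{n+1} e^{|p|²/4}` appearing in the 𝔚-norm. -/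
def wWeight (n : ℕ) (p : Euc n) : ℝ := (1 + ‖p‖) ^ (n + 1) * Real.exp (‖p‖ ^ 2 / 4)

/-- The 𝔚-norm `sup (1+|p|)^{n+1} e^{|p|²/4} |ψ|` over `Y × 𝕊ⁿ`. -/
def WNorm {n : ℕ} (Y : Set (Euc n)) (ψ : Euc n × Euc n → ℝ) : ℝ :=
  sSup ((fun x => wWeight n x.1 * |ψ x|) '' pts Y)

/-- Membership in the space 𝔚(Y) of rapidly decaying continuous functions. -/
def memW {n : ℕ} (Y : Set (Euc n)) (ψ : Euc n × Euc n → ℝ) : Prop :=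
  ContinuousOn ψ (pts Y) ∧ ∃ M : ℝ, ∀ x ∈ pts Y, wWeight n x.1 * |ψ x| ≤ M

/-- Supremum norm over `Y × 𝕊ⁿ`. -/
def nsup {n : ℕ} {F : Type*} [NormedAddCommGroup F] (Y : Set (Euc n))
    (f : Euc n × Euc n → F) : ℝ :=
  sSup ((fun x => ‖f x‖) '' pts Y)

/-- The set of Lipschitz constants of `f` on `Y × 𝕊ⁿ` (with the metric induced from
`ℝ^{n+1} × ℝ^{n+1}`). -/
def lipSet {n : ℕ} {F : Type*} [NormedAddCommGroup F] (Y : Set (Euc n))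
    (f : Euc n × Euc n → F) : Set ℝ :=
  {K : ℝ | 0 ≤ K ∧ ∀ x ∈ pts Y, ∀ y ∈ pts Y, ‖f x - f y‖ ≤ K * dist x y}

/-- The Lipschitz norm `‖f‖_{Lip}`: sup norm plus best Lipschitz constant. -/
def LipNorm {n : ℕ} {F : Type*} [NormedAddCommGroup F] (Y : Set (Euc n))
    (f : Euc n × Euc n → F) : ℝ :=
  nsup Y f + sInf (lipSet Y f)

/-- `f` is bounded and Lipschitz on `Y × 𝕊ⁿ`. -/
def IsBddLip {n : ℕ} {F : Type*} [NormedAddCommGroup F] (Y : Set (Euc n))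
    (f : Euc n × Euc n → F) : Prop :=
  (∃ M : ℝ, ∀ x ∈ pts Y, ‖f x‖ ≤ M) ∧ (lipSet Y f).Nonempty

/-- `g` is the spherical gradient `∇_{𝕊ⁿ} ψ` on `Y × 𝕊ⁿ`: at each `(p,v) ∈ Y × 𝕊ⁿ`,
`g(p,v)` is orthogonal to `v` and is the gradient of `ψ(p,·)` at `v` along the sphere. -/
def IsSphereGrad {n : ℕ} (Y : Set (Euc n)) (ψ : Euc n × Euc n → ℝ)
    (g : Euc n × Euc n → Euc n) : Prop :=
  ∀ x ∈ pts Y,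
    ⟪g x, x.2⟫ = 0 ∧
    HasFDerivWithinAt (fun v => ψ (x.1, v)) (innerSL ℝ (g x)) (Sph n) x.2

/-- The weighted gradient supremum `sup (1+|p|)|∇_{𝕊ⁿ}ψ|`. -/
def gradWsup {n : ℕ} (Y : Set (Euc n)) (g : Euc n × Euc n → Euc n) : ℝ :=
  sSup ((fun x => (1 + ‖x.1‖) * ‖g x‖) '' pts Y)

/-- Membership in the space 𝔛(Y). -/
def memX {n : ℕ} (Y : Set (Euc n)) (ψ : Euc n × Euc n → ℝ) : Prop :=
  IsBddLip Y ψ ∧ ∃ g : Euc n × Euc n → Euc n, IsSphereGrad Y ψ g ∧ IsBddLip Y g ∧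
    ∃ M : ℝ, ∀ x ∈ pts Y, (1 + ‖x.1‖) * ‖g x‖ ≤ M

/-- The 𝔛-norm `‖ψ‖_𝔛 = ‖ψ‖_{Lip} + ‖∇_{𝕊ⁿ}ψ‖_{Lip} + sup (1+|p|)|∇_{𝕊ⁿ}ψ|`
(as an infimum over representatives of the spherical gradient). -/
def XNorm {n : ℕ} (Y : Set (Euc n)) (ψ : Euc n × Euc n → ℝ) : ℝ :=
  sInf {r : ℝ | ∃ g : Euc n × Euc n → Euc n, IsSphereGrad Y ψ g ∧
    r = LipNorm Y ψ + LipNorm Y g + gradWsup Y g}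

/-- Membership in `𝔜′(Y) = 𝔛(Y) + 𝔚(Y)` (equality of functions on `Y × 𝕊ⁿ`). -/
def memYp {n : ℕ} (Y : Set (Euc n)) (ψ : Euc n × Euc n → ℝ) : Prop :=
  ∃ ζ ξ : Euc n × Euc n → ℝ, memX Y ζ ∧ memW Y ξ ∧ ∀ x ∈ pts Y, ψ x = ζ x + ξ x

/-- The 𝔜-norm `‖ψ‖_𝔜 = inf {‖ζ‖_𝔛 + ‖ξ‖_𝔚 : ψ = ζ + ξ}`. -/
def YNorm {n : ℕ} (Y : Set (Euc n)) (ψ : Euc n × Euc n → ℝ) : ℝ :=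
  sInf {r : ℝ | ∃ ζ ξ : Euc n × Euc n → ℝ, memX Y ζ ∧ memW Y ξ ∧
    (∀ x ∈ pts Y, ψ x = ζ x + ξ x) ∧ r = XNorm Y ζ + WNorm Y ξ}

/-- Continuous compactly supported functions on `Y × 𝕊ⁿ`. -/
def memCc {n : ℕ} (Y : Set (Euc n)) (φ : Euc n × Euc n → ℝ) : Prop :=
  ContinuousOn φ (pts Y) ∧
    ∃ K : Set (Euc n × Euc n), IsCompact K ∧ ∀ x ∈ pts Y, x ∉ K → φ x = 0

/-- Membership in `𝔜₀(Y)`: the closure of `C⁰_c(Y × 𝕊ⁿ)` in `𝔜′(Y)`. -/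
def memY0 {n : ℕ} (Y : Set (Euc n)) (ψ : Euc n × Euc n → ℝ) : Prop :=
  memYp Y ψ ∧ ∀ ε : ℝ, 0 < ε → ∃ φ, memCc Y φ ∧ YNorm Y (fun x => ψ x - φ x) < ε

/-- Membership in `𝔜(Y) = ℝ·𝟙 ⊕ 𝔜₀(Y)`. -/
def memY {n : ℕ} (Y : Set (Euc n)) (ψ : Euc n × Euc n → ℝ) : Prop :=
  ∃ (c : ℝ) (φ : Euc n × Euc n → ℝ), memY0 Y φ ∧ ∀ x ∈ pts Y, ψ x = c + φ x

lemma sphereGrad_unique {n : ℕ} {Y : Set (Euc n)} {ψ : Euc n × Euc n → ℝ}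
    {g g' : Euc n × Euc n → Euc n} (h : IsSphereGrad Y ψ g) (h' : IsSphereGrad Y ψ g')
    (x : Euc n × Euc n) (hx : x ∈ pts Y) : g x = g' x := by
  obtain ⟨h1, h2⟩ := h x hx
  obtain ⟨h1', h2'⟩ := h' x hx
  by_contra hne
  have hv : ‖x.2‖ = 1 := by
    have := hx.2
    simpa [Sph] using this
  set u : Euc n := g x - g' x with hu
  have hu0 : u ≠ 0 := sub_ne_zero.mpr hne
  have hun : ‖u‖ ≠ 0 := norm_ne_zero_iff.mpr hu0
  have huv : ⟪u, x.2⟫ = 0 := by rw [hu, inner_sub_left, h1, h1', sub_zero]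
  set w : Euc n := ‖u‖⁻¹ • u with hw
  have hwn : ‖w‖ = 1 := by rw [hw, norm_smul, norm_inv, norm_norm, inv_mul_cancel₀ hun]
  have hwv : ⟪x.2, w⟫ = 0 := by
    rw [hw, inner_smul_right, real_inner_comm, huv, mul_zero]
  set γ : ℝ → Euc n := fun t => Real.cos t • x.2 + Real.sin t • w with hγ
  have hγ0 : γ 0 = x.2 := by simp [hγ]
  have hγd : HasDerivAt γ w 0 := by
    have := ((Real.hasDerivAt_cos 0).smul_const x.2).add ((Real.hasDerivAt_sin 0).smul_const w)
    simp only [Real.sin_zero, neg_zero, zero_smul, Real.cos_zero, one_smul, zero_add] at this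
    exact this
  have hγS : ∀ t, γ t ∈ Sph n := by
    intro t
    have : ‖γ t‖ ^ 2 = 1 := by
      rw [hγ]
      simp only
      rw [norm_add_sq_real, norm_smul, norm_smul, inner_smul_left, inner_smul_right, hwv, hv, hwn]
      simp
    have h2 : ‖γ t‖ = 1 := by
      have := norm_nonneg (γ t)
      nlinarith
    simpa [Sph] using h2
  have key : ∀ G : Euc n, HasFDerivWithinAt (fun v => ψ (x.1, v)) (innerSL ℝ G) (Sph n) x.2 →
      HasDerivAt (fun t => ψ (x.1, γ t)) (⟪G, w⟫) 0 := by
    intro G hG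
    rw [← hγ0] at hG
    have := hG.comp_hasDerivWithinAt (s := Set.univ) (0 : ℝ) hγd.hasDerivWithinAt
      (fun t _ => hγS t)
    simpa [hasDerivWithinAt_univ, Function.comp_def] using this
  have e := (key _ h2).unique (key _ h2')
  have e2 : ⟪u, w⟫ = 0 := by rw [hu, inner_sub_left, e, sub_self]
  rw [hw, inner_smul_right, real_inner_self_eq_norm_sq] at e2
  have : ‖u‖ ^ 2 ≠ 0 := pow_ne_zero _ hun
  exact (mul_ne_zero (inv_ne_zero hun) this) e2

/-- Pointwise bound certificate for the 𝔜-norm. -/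
def YB {n : ℕ} (Y : Set (Euc n)) (f : Euc n × Euc n → ℝ) (r : ℝ) : Prop :=
  ∃ (ζ ξ : Euc n × Euc n → ℝ) (g : Euc n × Euc n → Euc n) (a b c d e w : ℝ),
    (0 ≤ a ∧ 0 ≤ b ∧ 0 ≤ c ∧ 0 ≤ d ∧ 0 ≤ e ∧ 0 ≤ w) ∧ a + b + c + d + e + w ≤ r ∧
    IsSphereGrad Y ζ g ∧ ContinuousOn ξ (pts Y) ∧ (∀ x ∈ pts Y, f x = ζ x + ξ x) ∧
    (∀ x ∈ pts Y, ‖ζ x‖ ≤ a) ∧ (∀ x ∈ pts Y, ∀ y ∈ pts Y, ‖ζ x - ζ y‖ ≤ b * dist x y) ∧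
    (∀ x ∈ pts Y, ‖g x‖ ≤ c) ∧ (∀ x ∈ pts Y, ∀ y ∈ pts Y, ‖g x - g y‖ ≤ d * dist x y) ∧
    (∀ x ∈ pts Y, (1 + ‖x.1‖) * ‖g x‖ ≤ e) ∧ (∀ x ∈ pts Y, wWeight n x.1 * |ξ x| ≤ w)

lemma wWeight_ge {n : ℕ} (p : Euc n) : 1 ≤ wWeight n p := by
  unfold wWeight
  have h1 : (1:ℝ) ≤ (1 + ‖p‖) ^ (n + 1) := one_le_pow₀ (by linarith [norm_nonneg p])
  have h2 : (1:ℝ) ≤ Real.exp (‖p‖ ^ 2 / 4) := Real.one_le_exp (by positivity)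
  nlinarith

lemma sSup_img_nonneg {α : Type*} {s : Set α} {F : α → ℝ} (h : ∀ x, 0 ≤ F x) :
    0 ≤ sSup (F '' s) := by
  apply Real.sSup_nonneg
  rintro _ ⟨x, -, rfl⟩
  exact h x

lemma sSup_img_le {α : Type*} {s : Set α} {F : α → ℝ} {a : ℝ} (ha : 0 ≤ a)
    (h : ∀ x ∈ s, F x ≤ a) : sSup (F '' s) ≤ a := by
  apply Real.sSup_le _ ha
  rintro _ ⟨x, hx, rfl⟩
  exact h x hx

lemma le_sSup_img {α : Type*} {s : Set α} {F : α → ℝ} {a : ℝ}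
    (h : ∀ x ∈ s, F x ≤ a) : ∀ x ∈ s, F x ≤ sSup (F '' s) := by
  intro x hx
  refine le_csSup ?_ (Set.mem_image_of_mem F hx)
  refine ⟨a, ?_⟩
  rintro _ ⟨x, hx, rfl⟩
  exact h x hx

lemma lip_sInf_nonneg {n : ℕ} {F : Type*} [NormedAddCommGroup F] (Y : Set (Euc n))
    (f : Euc n × Euc n → F) : 0 ≤ sInf (lipSet Y f) :=
  Real.sInf_nonneg fun _ h => h.1

lemma lip_attained {n : ℕ} {F : Type*} [NormedAddCommGroup F] {Y : Set (Euc n)}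
    {f : Euc n × Euc n → F} (h : (lipSet Y f).Nonempty) :
    ∀ x ∈ pts Y, ∀ y ∈ pts Y, ‖f x - f y‖ ≤ sInf (lipSet Y f) * dist x y := by
  intro x hx y hy
  rcases eq_or_ne x y with rfl | hne
  · simp
  · have hd : 0 < dist x y := dist_pos.mpr hne
    rw [← div_le_iff₀ hd]
    apply le_csInf h
    intro K hK
    rw [div_le_iff₀ hd]
    exact hK.2 x hx y hy

lemma lip_sInf_le {n : ℕ} {F : Type*} [NormedAddCommGroup F] {Y : Set (Euc n)}
    {f : Euc n × Euc n → F} {K : ℝ} (h : K ∈ lipSet Y f) : sInf (lipSet Y f) ≤ K :=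
  csInf_le (show BddBelow (lipSet Y f) from ⟨0, fun _ h => h.1⟩) h

lemma LipNorm_nonneg {n : ℕ} {F : Type*} [NormedAddCommGroup F] (Y : Set (Euc n))
    (f : Euc n × Euc n → F) : 0 ≤ LipNorm Y f :=
  add_nonneg (sSup_img_nonneg fun _ => norm_nonneg _) (lip_sInf_nonneg Y f)

lemma gradWsup_nonneg {n : ℕ} (Y : Set (Euc n)) (g : Euc n × Euc n → Euc n) :
    0 ≤ gradWsup Y g := sSup_img_nonneg fun _ => by positivity

lemma wmul_nonneg {n : ℕ} (p : Euc n) (t : ℝ) : 0 ≤ wWeight n p * |t| :=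
  mul_nonneg (by linarith [wWeight_ge p]) (abs_nonneg _)

lemma XNorm_nonneg {n : ℕ} (Y : Set (Euc n)) (f : Euc n × Euc n → ℝ) : 0 ≤ XNorm Y f := by
  apply Real.sInf_nonneg
  rintro _ ⟨g, -, rfl⟩
  linarith [LipNorm_nonneg Y f, LipNorm_nonneg Y g, gradWsup_nonneg Y g]

lemma WNorm_nonneg {n : ℕ} (Y : Set (Euc n)) (f : Euc n × Euc n → ℝ) : 0 ≤ WNorm Y f :=
  sSup_img_nonneg fun _ => wmul_nonneg _ _

lemma YB_of_lt {n : ℕ} {Y : Set (Euc n)} {f : Euc n × Euc n → ℝ} {r : ℝ} (hf : memYp Y f)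
    (h : YNorm Y f < r) : YB Y f r := by
  obtain ⟨ζ0, ξ0, h1, h2, h3⟩ := hf
  obtain ⟨_, ⟨ζ, ξ, hζ, hξ, hfe, rfl⟩, hlt⟩ := exists_lt_of_csInf_lt
    (s := {r : ℝ | ∃ ζ ξ : Euc n × Euc n → ℝ, memX Y ζ ∧ memW Y ξ ∧
      (∀ x ∈ pts Y, f x = ζ x + ξ x) ∧ r = XNorm Y ζ + WNorm Y ξ})
    ⟨_, ⟨ζ0, ξ0, h1, h2, h3, rfl⟩⟩ h
  obtain ⟨⟨⟨M, hM⟩, hL⟩, g0, hg0, ⟨⟨M1, hM1⟩, hL1⟩, M2, hM2⟩ := hζ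
  have hlt' : XNorm Y ζ < r - WNorm Y ξ := by linarith
  obtain ⟨_, ⟨g, hg, rfl⟩, hlt2⟩ := exists_lt_of_csInf_lt
    (s := {r : ℝ | ∃ g : Euc n × Euc n → Euc n, IsSphereGrad Y ζ g ∧
      r = LipNorm Y ζ + LipNorm Y g + gradWsup Y g}) ⟨_, ⟨g0, hg0, rfl⟩⟩ hlt'
  have hgg : ∀ x ∈ pts Y, g x = g0 x := sphereGrad_unique hg hg0
  obtain ⟨hξc, M3, hM3⟩ := hξ
  have hLg : (lipSet Y g).Nonempty := by
    obtain ⟨K, hK0, hK⟩ := hL1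
    refine ⟨K, hK0, fun x hx y hy => ?_⟩
    rw [hgg x hx, hgg y hy]
    exact hK x hx y hy
  refine ⟨ζ, ξ, g, nsup Y ζ, sInf (lipSet Y ζ), nsup Y g, sInf (lipSet Y g), gradWsup Y g,
    WNorm Y ξ, ⟨sSup_img_nonneg fun _ => norm_nonneg _, lip_sInf_nonneg _ _,
      sSup_img_nonneg fun _ => norm_nonneg _, lip_sInf_nonneg _ _, gradWsup_nonneg _ _,
      WNorm_nonneg _ _⟩, ?_, hg, hξc, hfe, le_sSup_img hM, lip_attained hL,
      le_sSup_img (a := M1) fun x hx => by rw [hgg x hx]; exact hM1 x hx, lip_attained hLg,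
      le_sSup_img (F := fun x => (1 + ‖x.1‖) * ‖g x‖) (a := M2)
        fun x hx => by simp only [hgg x hx]; exact hM2 x hx,
      le_sSup_img (F := fun x => wWeight n x.1 * |ξ x|) hM3⟩
  unfold LipNorm at hlt2
  linarith

lemma YB.memYp {n : ℕ} {Y : Set (Euc n)} {f : Euc n × Euc n → ℝ} {r : ℝ} (h : YB Y f r) :
    memYp Y f := by
  obtain ⟨ζ, ξ, g, a, b, c, d, e, w, ⟨ha, hb, hc, hd, he, hw⟩, hr, hg, hξ, hf, h1, h2, h3, h4,
    h5, h6⟩ := h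
  exact ⟨ζ, ξ, ⟨⟨⟨a, h1⟩, b, hb, h2⟩, g, hg, ⟨⟨c, h3⟩, d, hd, h4⟩, e, h5⟩, ⟨hξ, w, h6⟩, hf⟩

lemma YB.le {n : ℕ} {Y : Set (Euc n)} {f : Euc n × Euc n → ℝ} {r : ℝ} (h : YB Y f r) :
    YNorm Y f ≤ r := by
  obtain ⟨ζ, ξ, g, a, b, c, d, e, w, ⟨ha, hb, hc, hd, he, hw⟩, hr, hg, hξ, hf, h1, h2, h3, h4,
    h5, h6⟩ := h
  have hY : YNorm Y f ≤ XNorm Y ζ + WNorm Y ξ := by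
    apply csInf_le
    · refine ⟨0, ?_⟩
      rintro _ ⟨ζ, ξ, -, -, -, rfl⟩
      exact add_nonneg (XNorm_nonneg _ _) (WNorm_nonneg _ _)
    · exact ⟨ζ, ξ, ⟨⟨⟨a, h1⟩, b, hb, h2⟩, g, hg, ⟨⟨c, h3⟩, d, hd, h4⟩, e, h5⟩, ⟨hξ, w, h6⟩, hf, rfl⟩
  have hX : XNorm Y ζ ≤ LipNorm Y ζ + LipNorm Y g + gradWsup Y g := by
    apply csInf_le
    · refine ⟨0, ?_⟩
      rintro _ ⟨g, -, rfl⟩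
      linarith [LipNorm_nonneg Y ζ, LipNorm_nonneg Y g, gradWsup_nonneg Y g]
    · exact ⟨g, hg, rfl⟩
  have k1 : nsup Y ζ ≤ a := sSup_img_le ha h1
  have k2 : sInf (lipSet Y ζ) ≤ b := lip_sInf_le ⟨hb, h2⟩
  have k3 : nsup Y g ≤ c := sSup_img_le hc h3
  have k4 : sInf (lipSet Y g) ≤ d := lip_sInf_le ⟨hd, h4⟩
  have k5 : gradWsup Y g ≤ e := sSup_img_le he h5
  have k6 : WNorm Y ξ ≤ w := sSup_img_le hw h6
  unfold LipNorm at hX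
  linarith

lemma YB.congr {n : ℕ} {Y : Set (Euc n)} {f f' : Euc n × Euc n → ℝ} {r r' : ℝ} (h : YB Y f r)
    (hr' : r ≤ r') (hff : ∀ x ∈ pts Y, f' x = f x) : YB Y f' r' := by
  obtain ⟨ζ, ξ, g, a, b, c, d, e, w, h0, hr, hg, hξ, hf, h1⟩ := h
  exact ⟨ζ, ξ, g, a, b, c, d, e, w, h0, hr.trans hr', hg, hξ,
    fun x hx => (hff x hx).trans (hf x hx), h1⟩

lemma YB.abs_le {n : ℕ} {Y : Set (Euc n)} {f : Euc n × Euc n → ℝ} {r : ℝ} (h : YB Y f r) :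
    ∀ x ∈ pts Y, |f x| ≤ r := by
  obtain ⟨ζ, ξ, g, a, b, c, d, e, w, ⟨ha, hb, hc, hd, he, hw⟩, hr, hg, hξ, hf, h1, h2, h3, h4,
    h5, h6⟩ := h
  intro x hx
  have k1 := h1 x hx
  have k6 := h6 x hx
  have k7 : |ξ x| ≤ wWeight n x.1 * |ξ x| :=
    le_mul_of_one_le_left (abs_nonneg _) (wWeight_ge _)
  rw [hf x hx]
  rw [Real.norm_eq_abs] at k1
  linarith [abs_add_le (ζ x) (ξ x)]

lemma YB.add {n : ℕ} {Y : Set (Euc n)} {f f' : Euc n × Euc n → ℝ} {r r' : ℝ} (h : YB Y f r)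
    (h' : YB Y f' r') : YB Y (fun x => f x + f' x) (r + r') := by
  obtain ⟨ζ, ξ, g, a, b, c, d, e, w, ⟨ha, hb, hc, hd, he, hw⟩, hr, hg, hξ, hf, h1, h2, h3, h4,
    h5, h6⟩ := h
  obtain ⟨ζ', ξ', g', a', b', c', d', e', w', ⟨ha', hb', hc', hd', he', hw'⟩, hr', hg', hξ', hf',
    h1', h2', h3', h4', h5', h6'⟩ := h'
  refine ⟨fun x => ζ x + ζ' x, fun x => ξ x + ξ' x, fun x => g x + g' x, a + a', b + b', c + c',
    d + d', e + e', w + w', ⟨by linarith, by linarith, by linarith, by linarith, by linarith,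
    by linarith⟩, by linarith, ?_, hξ.add hξ', ?_, ?_, ?_, ?_, ?_, ?_, ?_⟩
  · intro x hx
    refine ⟨by rw [inner_add_left, (hg x hx).1, (hg' x hx).1, add_zero], ?_⟩
    rw [map_add]
    exact (hg x hx).2.add (hg' x hx).2
  · intro x hx
    simp only [hf x hx, hf' x hx]
    ring
  · intro x hx
    exact (norm_add_le _ _).trans (add_le_add (h1 x hx) (h1' x hx))
  · intro x hx y hy
    rw [add_sub_add_comm, add_mul]
    exact (norm_add_le _ _).trans (add_le_add (h2 x hx y hy) (h2' x hx y hy))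
  · intro x hx
    exact (norm_add_le _ _).trans (add_le_add (h3 x hx) (h3' x hx))
  · intro x hx y hy
    rw [add_sub_add_comm, add_mul]
    exact (norm_add_le _ _).trans (add_le_add (h4 x hx y hy) (h4' x hx y hy))
  · intro x hx
    refine le_trans ?_ (add_le_add (h5 x hx) (h5' x hx))
    rw [← mul_add]
    exact mul_le_mul_of_nonneg_left (norm_add_le _ _) (by positivity)
  · intro x hx
    refine le_trans ?_ (add_le_add (h6 x hx) (h6' x hx))
    rw [← mul_add]
    exact mul_le_mul_of_nonneg_left (abs_add_le _ _) (by linarith [wWeight_ge x.1])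

lemma YB.smul {n : ℕ} {Y : Set (Euc n)} {f : Euc n × Euc n → ℝ} {r : ℝ} (k : ℝ) (h : YB Y f r) :
    YB Y (fun x => k * f x) (|k| * r) := by
  obtain ⟨ζ, ξ, g, a, b, c, d, e, w, ⟨ha, hb, hc, hd, he, hw⟩, hr, hg, hξ, hf, h1, h2, h3, h4,
    h5, h6⟩ := h
  have hk := abs_nonneg k
  refine ⟨fun x => k * ζ x, fun x => k * ξ x, fun x => k • g x, |k| * a, |k| * b, |k| * c,
    |k| * d, |k| * e, |k| * w, ⟨by positivity, by positivity, by positivity, by positivity,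
    by positivity, by positivity⟩, ?_, ?_, hξ.const_mul k, ?_, ?_, ?_, ?_, ?_, ?_, ?_⟩
  · have := mul_le_mul_of_nonneg_left hr hk
    linarith
  · intro x hx
    refine ⟨by rw [real_inner_smul_left, (hg x hx).1, mul_zero], ?_⟩
    have : innerSL ℝ (k • g x) = k • innerSL ℝ (g x) := by
      ext v; simp [inner_smul_left]
    rw [this]
    exact (hg x hx).2.const_mul k
  · intro x hx
    simp only [hf x hx]
    ring
  · intro x hx
    rw [norm_mul, Real.norm_eq_abs k]
    exact mul_le_mul_of_nonneg_left (h1 x hx) hk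
  · intro x hx y hy
    rw [← mul_sub, norm_mul, Real.norm_eq_abs k, mul_assoc]
    exact mul_le_mul_of_nonneg_left (h2 x hx y hy) hk
  · intro x hx
    rw [norm_smul, Real.norm_eq_abs k]
    exact mul_le_mul_of_nonneg_left (h3 x hx) hk
  · intro x hx y hy
    rw [← smul_sub, norm_smul, Real.norm_eq_abs k, mul_assoc]
    exact mul_le_mul_of_nonneg_left (h4 x hx y hy) hk
  · intro x hx
    rw [norm_smul, Real.norm_eq_abs k, mul_left_comm]
    exact mul_le_mul_of_nonneg_left (h5 x hx) hk
  · intro x hx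
    rw [abs_mul, mul_left_comm]
    exact mul_le_mul_of_nonneg_left (h6 x hx) hk

lemma YB.sub {n : ℕ} {Y : Set (Euc n)} {f f' : Euc n × Euc n → ℝ} {r r' : ℝ} (h : YB Y f r)
    (h' : YB Y f' r') : YB Y (fun x => f x - f' x) (r + r') :=
  (h.add (h'.smul (-1))).congr (by simp) (fun x _ => by ring)

lemma YB_const {n : ℕ} (Y : Set (Euc n)) (k : ℝ) : YB Y (fun _ => k) |k| := by
  refine ⟨fun _ => k, fun _ => 0, fun _ => 0, |k|, 0, 0, 0, 0, 0, ?_, by simp, ?_,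
    continuousOn_const, by simp, by simp, by simp, by simp, by simp, by simp, by simp⟩
  · simp
  · intro x hx
    refine ⟨by simp, ?_⟩
    rw [map_zero]
    exact hasFDerivWithinAt_const _ _ _

lemma YB_of_memYp {n : ℕ} {Y : Set (Euc n)} {f : Euc n × Euc n → ℝ} (h : memYp Y f) :
    ∃ r, YB Y f r := ⟨_, YB_of_lt h (lt_add_one _)⟩

lemma YB_of_Cc {n : ℕ} {Y : Set (Euc n)} (hY : IsClosed Y) {φ : Euc n × Euc n → ℝ}
    (h : memCc Y φ) : ∃ r, YB Y φ r := by
  obtain ⟨hc, K, hK, h0⟩ := h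
  apply YB_of_memYp
  refine ⟨fun _ => 0, φ, ?_, ⟨hc, ?_⟩, by simp⟩
  · obtain ⟨ζ, ξ, g, a, b, c, d, e, w, -⟩ := YB_const Y 0
    refine ⟨⟨⟨0, by simp⟩, 0, le_rfl, by simp⟩, fun _ => 0, ?_, ⟨⟨0, by simp⟩, 0, le_rfl, by simp⟩,
      0, by simp⟩
    intro x hx
    refine ⟨by simp, ?_⟩
    rw [map_zero]
    exact hasFDerivWithinAt_const _ _ _
  · have hcl : IsClosed (pts Y) := hY.prod Metric.isClosed_sphere
    have hKc : IsCompact (K ∩ pts Y) := hK.inter_right hcl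
    have hw : Continuous (fun x : Euc n × Euc n => wWeight n x.1) := by
      unfold wWeight
      fun_prop
    have hF : ContinuousOn (fun x : Euc n × Euc n => wWeight n x.1 * |φ x|) (K ∩ pts Y) :=
      hw.continuousOn.mul (hc.mono Set.inter_subset_right).abs
    obtain ⟨M, hM⟩ := hKc.bddAbove_image hF
    refine ⟨max M 0, fun x hx => ?_⟩
    by_cases hxK : x ∈ K
    · exact le_max_of_le_left (hM ⟨x, ⟨hxK, hx⟩, rfl⟩)
    · rw [h0 x hx hxK]; simp

lemma memY0_iff {n : ℕ} {Y : Set (Euc n)} (hY : IsClosed Y) {ψ : Euc n × Euc n → ℝ} :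
    memY0 Y ψ ↔ ∀ ε : ℝ, 0 < ε → ∃ φ, memCc Y φ ∧ YB Y (fun x => ψ x - φ x) ε := by
  constructor
  · rintro ⟨h1, h2⟩ ε hε
    obtain ⟨φ, hφ, hlt⟩ := h2 ε hε
    obtain ⟨r, hr⟩ := YB_of_memYp h1
    obtain ⟨s, hs⟩ := YB_of_Cc hY hφ
    exact ⟨φ, hφ, YB_of_lt (hr.sub hs).memYp hlt⟩
  · intro h
    refine ⟨?_, fun ε hε => ?_⟩
    · obtain ⟨φ, hφ, hB⟩ := h 1 one_pos
      obtain ⟨s, hs⟩ := YB_of_Cc hY hφ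
      exact ((hB.add hs).congr le_rfl (fun x _ => by ring)).memYp
    · obtain ⟨φ, hφ, hB⟩ := h (ε / 2) (by linarith)
      exact ⟨φ, hφ, by linarith [hB.le]⟩

lemma memCc.add {n : ℕ} {Y : Set (Euc n)} {φ φ' : Euc n × Euc n → ℝ} (h : memCc Y φ)
    (h' : memCc Y φ') : memCc Y (fun x => φ x + φ' x) := by
  obtain ⟨hc, K, hK, h0⟩ := h
  obtain ⟨hc', K', hK', h0'⟩ := h'
  refine ⟨hc.add hc', K ∪ K', hK.union hK', fun x hx hn => ?_⟩
  rw [Set.mem_union, not_or] at hn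
  simp [h0 x hx hn.1, h0' x hx hn.2]

lemma memCc.smul {n : ℕ} {Y : Set (Euc n)} {φ : Euc n × Euc n → ℝ} (k : ℝ) (h : memCc Y φ) :
    memCc Y (fun x => k * φ x) := by
  obtain ⟨hc, K, hK, h0⟩ := h
  exact ⟨hc.const_mul k, K, hK, fun x hx hn => by simp [h0 x hx hn]⟩

lemma memY0_limit {n : ℕ} {Y : Set (Euc n)} (hY : IsClosed Y) {ψ : Euc n × Euc n → ℝ}
    (h : memY0 Y ψ) (ε : ℝ) (hε : 0 < ε) :
    ∃ R : ℝ, ∀ x ∈ pts Y, R < ‖x.1‖ → |ψ x| ≤ ε := by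
  obtain ⟨φ, ⟨hc, K, hK, h0⟩, hB⟩ := (memY0_iff hY).1 h ε hε
  obtain ⟨R, hR⟩ := hK.isBounded.exists_norm_le
  refine ⟨R, fun x hx hxR => ?_⟩
  have hxK : x ∉ K := fun hxK => by
    have := hR x hxK
    linarith [norm_fst_le x]
  have := hB.abs_le x hx
  rwa [h0 x hx hxK, sub_zero] at this

lemma exists_far {n : ℕ} {Y : Set (Euc n)} (hY : ¬ Bornology.IsBounded Y) (R : ℝ) :
    ∃ x ∈ pts Y, R < ‖x.1‖ := by
  by_contra! hcon
  apply hY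
  rw [isBounded_iff_forall_norm_le]
  refine ⟨R, fun p hp => ?_⟩
  obtain ⟨v, hv⟩ : (Sph n).Nonempty := (NormedSpace.sphere_nonempty (E := Euc n)).2 zero_le_one
  exact hcon (p, v) ⟨hp, hv⟩

lemma const_bound {n : ℕ} {Y : Set (Euc n)} (hYc : IsClosed Y) (hY : ¬ Bornology.IsBounded Y)
    {c₁ c₂ s : ℝ} {φ₁ φ₂ : Euc n × Euc n → ℝ} (h₁ : memY0 Y φ₁) (h₂ : memY0 Y φ₂)
    (h : ∀ x ∈ pts Y, |(c₁ + φ₁ x) - (c₂ + φ₂ x)| ≤ s) : |c₁ - c₂| ≤ s := by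
  apply le_of_forall_pos_le_add
  intro ε hε
  obtain ⟨R₁, hR₁⟩ := memY0_limit hYc h₁ (ε / 2) (by linarith)
  obtain ⟨R₂, hR₂⟩ := memY0_limit hYc h₂ (ε / 2) (by linarith)
  obtain ⟨x, hx, hxR⟩ := exists_far hY (max R₁ R₂)
  have k1 := abs_le.1 (hR₁ x hx (lt_of_le_of_lt (le_max_left _ _) hxR))
  have k2 := abs_le.1 (hR₂ x hx (lt_of_le_of_lt (le_max_right _ _) hxR))
  have k3 := abs_le.1 (h x hx)
  rw [abs_le]
  constructor <;> linarith [k1.1, k1.2, k2.1, k2.2, k3.1, k3.2]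

lemma memY0_zero {n : ℕ} {Y : Set (Euc n)} (hYc : IsClosed Y) :
    memY0 Y (fun _ => (0 : ℝ)) := by
  rw [memY0_iff hYc]
  intro ε hε
  exact ⟨fun _ => 0, ⟨continuousOn_const, ∅, isCompact_empty, fun _ _ _ => rfl⟩,
    (YB_const Y 0).congr (by simpa using hε.le) (by simp)⟩

lemma memY_sub {n : ℕ} {Y : Set (Euc n)} {ψ : Euc n × Euc n → ℝ} (h : memY Y ψ) :
    memYp Y ψ := by
  obtain ⟨c, φ, hφ, he⟩ := h
  obtain ⟨r, hr⟩ := YB_of_memYp hφ.1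
  exact (((YB_const Y c).add hr).congr le_rfl he).memYp

lemma memY_closed {n : ℕ} {Y : Set (Euc n)} (hYc : IsClosed Y) (hY : ¬ Bornology.IsBounded Y)
    {ψ : Euc n × Euc n → ℝ} (hψ : memYp Y ψ)
    (h : ∀ ε : ℝ, 0 < ε → ∃ φ, memY Y φ ∧ YNorm Y (fun x => ψ x - φ x) < ε) : memY Y ψ := by
  have h' : ∀ k : ℕ, ∃ (c : ℝ) (φ : Euc n × Euc n → ℝ), memY0 Y φ ∧
      YB Y (fun x => ψ x - (c + φ x)) (1 / ((k : ℝ) + 1)) := by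
    intro k
    obtain ⟨f, hf, hlt⟩ := h (1 / ((k : ℝ) + 1)) (by positivity)
    obtain ⟨r, hr⟩ := YB_of_memYp hψ
    obtain ⟨s, hs⟩ := YB_of_memYp (memY_sub hf)
    have hB := YB_of_lt (hr.sub hs).memYp hlt
    obtain ⟨c, φ, hφ, he⟩ := hf
    exact ⟨c, φ, hφ, hB.congr le_rfl (fun x hx => by rw [he x hx])⟩
  choose c φ hφ hB using h'
  have hb0 : Tendsto (fun k : ℕ => 1 / ((k : ℝ) + 1)) atTop (nhds 0) :=
    tendsto_one_div_add_atTop_nhds_zero_nat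
  have hcd : ∀ k l, |c k - c l| ≤ 1 / ((k : ℝ) + 1) + 1 / ((l : ℝ) + 1) := by
    intro k l
    apply const_bound hYc hY (hφ k) (hφ l)
    intro x hx
    have k1 := abs_le.1 ((hB k).abs_le x hx)
    have k2 := abs_le.1 ((hB l).abs_le x hx)
    rw [abs_le]
    constructor <;> linarith [k1.1, k1.2, k2.1, k2.2]
  have hcau : CauchySeq c := by
    refine cauchySeq_of_le_tendsto_0' (fun k : ℕ => 2 * (1 / ((k : ℝ) + 1))) ?_ ?_
    · intro k l hkl
      rw [Real.dist_eq]
      have : 1 / ((l : ℝ) + 1) ≤ 1 / ((k : ℝ) + 1) := by gcongr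
      linarith [hcd k l]
    · simpa using hb0.const_mul 2
  obtain ⟨C, hC⟩ := cauchySeq_tendsto_of_complete hcau
  refine ⟨C, fun x => ψ x - C, ?_, fun x _ => by ring⟩
  rw [memY0_iff hYc]
  intro ε hε
  have e1 := hb0.eventually (gt_mem_nhds (show (0:ℝ) < ε / 3 by linarith))
  have e2 := (Metric.tendsto_nhds.1 hC) (ε / 3) (by linarith)
  obtain ⟨k, hk1, hk2⟩ := (e1.and e2).exists
  rw [Real.dist_eq] at hk2
  obtain ⟨f, hf, hfB⟩ := (memY0_iff hYc).1 (hφ k) (ε / 3) (by linarith)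
  refine ⟨f, hf, (((hB k).add (YB_const Y (c k - C))).add hfB).congr (by linarith) ?_⟩
  intro x hx
  ring

/-- For `n ≥ 2` and `Y ⊆ ℝ^{n+1}` unbounded and closed, `𝔜(Y)` is a
closed linear subspace of the Banach space `𝔜′(Y)`, the constant function `𝟙` does not lie
in `𝔜₀(Y)`, and the decomposition `c·𝟙 + ψ` with `ψ ∈ 𝔜₀(Y)` is unique. -/
theorem YSpace_closed_subspace_unique_decomposition
    (n : ℕ) (hn : 2 ≤ n) (Y : Set (Euc n)) (hYclosed : IsClosed Y)
    (hYunbounded : ¬ Bornology.IsBounded Y) :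
    -- 𝔜(Y) ⊆ 𝔜′(Y)
    (∀ ψ, memY Y ψ → memYp Y ψ) ∧
    -- 𝔜(Y) is a linear subspace
    memY Y (fun _ => (0 : ℝ)) ∧
    (∀ ψ₁ ψ₂, memY Y ψ₁ → memY Y ψ₂ → memY Y (fun x => ψ₁ x + ψ₂ x)) ∧
    (∀ (c : ℝ) ψ, memY Y ψ → memY Y (fun x => c * ψ x)) ∧
    -- 𝔜(Y) is closed in 𝔜′(Y)
    (∀ ψ, memYp Y ψ →
      (∀ ε : ℝ, 0 < ε → ∃ φ, memY Y φ ∧ YNorm Y (fun x => ψ x - φ x) < ε) →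
      memY Y ψ) ∧
    -- 𝟙 ∉ 𝔜₀(Y)
    ¬ memY0 Y (fun _ => (1 : ℝ)) ∧
    -- uniqueness of the decomposition
    (∀ (c₁ c₂ : ℝ) (φ₁ φ₂ : Euc n × Euc n → ℝ), memY0 Y φ₁ → memY0 Y φ₂ →
      (∀ x ∈ pts Y, c₁ + φ₁ x = c₂ + φ₂ x) →
      c₁ = c₂ ∧ ∀ x ∈ pts Y, φ₁ x = φ₂ x) := by
  have huniq : ∀ (c₁ c₂ : ℝ) (φ₁ φ₂ : Euc n × Euc n → ℝ), memY0 Y φ₁ → memY0 Y φ₂ →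
      (∀ x ∈ pts Y, c₁ + φ₁ x = c₂ + φ₂ x) → c₁ = c₂ := by
    intro c₁ c₂ φ₁ φ₂ h₁ h₂ h
    have := const_bound (c₁ := c₁) (c₂ := c₂) (s := 0) hYclosed hYunbounded h₁ h₂
      (fun x hx => by rw [h x hx]; simp)
    exact sub_eq_zero.1 (abs_nonpos_iff.1 this)
  refine ⟨fun ψ h => memY_sub h, ⟨0, fun _ => 0, memY0_zero hYclosed, by simp⟩, ?_, ?_,
    fun ψ hψ h => memY_closed hYclosed hYunbounded hψ h, ?_, ?_⟩
  · rintro ψ₁ ψ₂ ⟨c₁, φ₁, h₁, e₁⟩ ⟨c₂, φ₂, h₂, e₂⟩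
    refine ⟨c₁ + c₂, fun x => φ₁ x + φ₂ x, ?_, fun x hx => by simp only [e₁ x hx, e₂ x hx]; ring⟩
    rw [memY0_iff hYclosed] at h₁ h₂ ⊢
    intro ε hε
    obtain ⟨f₁, hf₁, B₁⟩ := h₁ (ε / 2) (by linarith)
    obtain ⟨f₂, hf₂, B₂⟩ := h₂ (ε / 2) (by linarith)
    exact ⟨_, hf₁.add hf₂, (B₁.add B₂).congr (by linarith) (fun x _ => by ring)⟩
  · rintro c ψ ⟨c₁, φ₁, h₁, e₁⟩
    refine ⟨c * c₁, fun x => c * φ₁ x, ?_, fun x hx => by simp only [e₁ x hx]; ring⟩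
    rw [memY0_iff hYclosed] at h₁ ⊢
    intro ε hε
    have hp : 0 < |c| + 1 := by positivity
    obtain ⟨f₁, hf₁, B₁⟩ := h₁ (ε / (|c| + 1)) (by positivity)
    refine ⟨_, hf₁.smul c, (B₁.smul c).congr ?_ (fun x _ => by ring)⟩
    rw [← mul_div_assoc, div_le_iff₀ hp]
    nlinarith
  · intro h
    have := huniq 0 1 (fun _ => 1) (fun _ => 0) h (memY0_zero hYclosed) (by simp)
    norm_num at this
  · intro c₁ c₂ φ₁ φ₂ h₁ h₂ h
    have hc := huniq c₁ c₂ φ₁ φ₂ h₁ h₂ h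
    refine ⟨hc, fun x hx => ?_⟩
    have := h x hx
    rw [hc] at this
    linarith
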